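/- arXiv:1605.01068 — 2 statements merged into one kernel-verified Lean document; each statement's English description precedes it below -/
import Mathlib

section
/- Let k = (k_1,…,k_m) with Σ k_i = n and d = (d_1,…,d_m). The proportion i(n, k, d) of permutations π ∈ S_n admitting pairwise disjoint invariant sets A_1,…,A_m with |A_i| = k_i and all cycles of π|_{A_i} of length divisible by d_i satisfies i(n, k, d) ≤ k_1^{-1+1/d_1} ⋯ k_m^{-1+1/d_m}. -/
/-- `iProp n m k d` is the proportion of permutations `π` of `n` points that admit
pairwise disjoint `π`-invariant sets `A 0, …, A (m-1)` with `(A i).card = k i` and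
all cycles of `π` restricted to `A i` of length divisible by `d i`. -/
noncomputable def iProp (n m : ℕ) (k d : Fin m → ℕ) : ℝ :=
  (Nat.card {π : Equiv.Perm (Fin n) //
      ∃ A : Fin m → Finset (Fin n),
        (∀ i j, i ≠ j → Disjoint (A i) (A j)) ∧
        (∀ i, (A i).card = k i) ∧
        (∀ i, ∀ x ∈ A i, π x ∈ A i) ∧
        (∀ i, ∀ x ∈ A i, d i ∣ Function.minimalPeriod (⇑π) x)} : ℝ) /
    (n.factorial : ℝ)

open Equiv Finset

section Counting

variable {α β : Type}

/-- `σ` advances some `ZMod d`-valued grading by one at every point; equivalently, all cycle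
lengths of `σ` are divisible by `d`. -/
def IsGraded (d : ℕ) (σ : Perm α) : Prop :=
  ∃ f : α → ZMod d, ∀ z, f (σ z) = f z + 1

/-- `σ` advances some `ZMod d`-valued grading by one at every point, except that the step
into `x` has a defect equal to the number of points; equivalently, all cycles of `σ` avoiding `x`
have length divisible by `d`. -/
def IsGradedAway (d : ℕ) (σ : Perm α) (x : α) : Prop :=
  ∃ f : α → ZMod d, ∀ z, f (σ z) + (Nat.card α : ZMod d) * Set.indicator {x} 1 (σ z) = f z + 1

theorem IsGraded.dvd_card [Fintype α] {d : ℕ} {σ : Perm α} (h : IsGraded d σ) :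
    d ∣ Nat.card α := by
  obtain ⟨f, hf⟩ := h
  have h1 : ∑ z, f (σ z) = ∑ z, f z := Equiv.sum_comp σ f
  simp only [hf, Finset.sum_add_distrib] at h1
  rw [← ZMod.natCast_eq_zero_iff]
  simpa using h1

theorem IsGraded.away [Fintype α] {d : ℕ} {σ : Perm α} (h : IsGraded d σ) (x : α) :
    IsGradedAway d σ x := by
  have h0 := (ZMod.natCast_eq_zero_iff _ _).2 h.dvd_card
  obtain ⟨f, hf⟩ := h
  exact ⟨f, fun z => by rw [h0, zero_mul, add_zero, hf]⟩

theorem IsGraded.permCongr {d : ℕ} {σ : Perm α} (h : IsGraded d σ) (e : α ≃ β) :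
    IsGraded d (e.permCongr σ) := by
  obtain ⟨f, hf⟩ := h
  exact ⟨f ∘ e.symm, fun z => by simp [Equiv.permCongr_apply, hf]⟩

theorem IsGradedAway.permCongr {d : ℕ} {σ : Perm α} {x : α} (h : IsGradedAway d σ x)
    (e : α ≃ β) : IsGradedAway d (e.permCongr σ) (e x) := by
  obtain ⟨f, hf⟩ := h
  refine ⟨f ∘ e.symm, fun z => ?_⟩
  classical
  rw [← Nat.card_congr e]
  simpa [Equiv.permCongr_apply, Set.indicator_apply] using hf (e.symm z)

theorem IsGradedAway.removeNone_of_fixed [Fintype β] {d : ℕ} {π : Perm (Option β)}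
    (h : IsGradedAway d π none) (hπ : π none = none) : IsGraded d (removeNone π) := by
  obtain ⟨f, hf⟩ := h
  refine ⟨f ∘ some, fun z => ?_⟩
  obtain ⟨w, hw⟩ : ∃ w, π (some z) = some w :=
    Option.ne_none_iff_exists'.1 fun h => by simpa using π.injective (h.trans hπ.symm)
  have := hf (some z)
  rw [hw] at this
  simpa [removeNone_some π ⟨w, hw⟩, hw] using this

theorem IsGradedAway.removeNone_of_eq_some [Fintype β] {d : ℕ} {π : Perm (Option β)} {y : β}
    (h : IsGradedAway d π none) (hπ : π none = some y) : IsGradedAway d (removeNone π) y := by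
  obtain ⟨f, hf⟩ := h
  refine ⟨f ∘ some, fun z => ?_⟩
  have h0 := hf none
  have h1 := hf (some z)
  rcases hw : π (some z) with _ | w
  · have h2 : removeNone π z = y := by
      have := removeNone_none π hw
      rw [hπ] at this
      exact Option.some_injective _ this
    rw [hw] at h1
    rw [hπ] at h0
    simp [h2] at h0 h1 ⊢
    rw [h0]
    linear_combination h1
  · have h2 : removeNone π z = w := by
      have := removeNone_some π ⟨w, hw⟩
      rw [hw] at this
      exact Option.some_injective _ this
    have h3 : w ≠ y := by
      rintro rfl
      simpa using π.injective (hw.trans hπ.symm)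
    rw [hw] at h1
    simpa [h2, h3] using h1

open Classical in
theorem card_isGradedAway_none_le [Fintype β] [DecidableEq β] (d : ℕ) (y₀ : β) :
    #{π : Perm (Option β) | IsGradedAway d π none} ≤
      (if d ∣ Nat.card β then #{σ : Perm β | IsGradedAway d σ y₀} else 0) +
        ∑ y : β, #{σ : Perm β | IsGradedAway d σ y} := by
  let S : Option β → Finset (Perm β) := fun o =>
    o.elim (if d ∣ Nat.card β then univ.filter (IsGradedAway d · y₀) else ∅)
      fun y => univ.filter (IsGradedAway d · y)
  calc _ ≤ #(univ.sigma S) := by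
        refine card_le_card_of_injOn (fun π => ⟨π none, removeNone π⟩) ?_ ?_
        · intro π hπ
          simp only [coe_filter, mem_univ, true_and, Set.mem_ofPred_eq] at hπ
          simp only [coe_sigma, Set.mem_sigma_iff, mem_coe, mem_univ, true_and]
          rcases h : π none with _ | y
          · have hg := hπ.removeNone_of_fixed h
            simp only [S, Option.elim, if_pos hg.dvd_card, mem_filter, mem_univ, true_and]
            exact hg.away y₀
          · simpa [S] using hπ.removeNone_of_eq_some h
        · intro π _ π' _ h
          simp only [Sigma.mk.injEq, heq_eq_eq] at h
          exact Equiv.Perm.decomposeOption.injective (Prod.ext h.1 h.2)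
    _ = _ := by
        rw [card_sigma, Fintype.sum_option]
        simp only [S, Option.elim]
        split_ifs <;> rfl

open Classical in
theorem card_isGradedAway_le (d N : ℕ) :
    ∀ {α : Type} [Fintype α] [DecidableEq α] (x : α), Nat.card α = N + 1 →
      #{σ : Perm α | IsGradedAway d σ x} ≤ ∏ t ∈ range (N + 1), (t + if d ∣ t then 1 else 0) := by
  induction N with
  | zero =>
    intro α _ _ x hα
    have : Fintype.card α = 1 := by simpa using hα
    refine (card_filter_le _ _).trans ?_
    simp [Fintype.card_perm, this]
  | succ N ih =>
    intro α _ _ x hα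
    let e : α ≃ Option {z // z ≠ x} := (optionSubtypeNe x).symm
    have hβ : Nat.card {z // z ≠ x} = N + 1 := by
      have := Nat.card_congr e
      rw [hα, Finite.card_option] at this
      omega
    obtain ⟨y₀⟩ : Nonempty {z // z ≠ x} := (Nat.card_pos_iff.1 (by omega)).1
    calc #{σ : Perm α | IsGradedAway d σ x}
        ≤ #{π : Perm (Option {z // z ≠ x}) | IsGradedAway d π none} := by
          refine card_le_card_of_injOn e.permCongr ?_ e.permCongr.injective.injOn
          intro σ hσ
          simp only [coe_filter, mem_univ, true_and, Set.mem_ofPred_eq] at hσ ⊢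
          simpa [e] using hσ.permCongr e
      _ ≤ _ := card_isGradedAway_none_le d y₀
      _ ≤ (if d ∣ N + 1 then ∏ t ∈ range (N + 1), (t + if d ∣ t then 1 else 0) else 0) +
            ∑ _y : {z // z ≠ x}, ∏ t ∈ range (N + 1), (t + if d ∣ t then 1 else 0) := by
          rw [hβ]
          gcongr with y
          · split_ifs
            · exact ih y₀ hβ
            · rfl
          · exact ih y hβ
      _ = _ := by
          rw [prod_range_succ _ (N + 1), sum_const, card_univ, ← Nat.card_eq_fintype_card, hβ]
          split_ifs <;> simp <;> ring

open Classical in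
theorem card_isGraded_le (d k : ℕ) (hk : 0 < k) :
    #{σ : Perm (Fin k) | IsGraded d σ} ≤ ∏ t ∈ range k, (t + if d ∣ t then 1 else 0) := by
  obtain ⟨N, rfl⟩ : ∃ N, k = N + 1 := ⟨k - 1, by omega⟩
  have h0 := card_isGradedAway_le d N (0 : Fin (N + 1)) (Nat.card_fin _)
  refine (card_le_card fun σ hσ => ?_).trans h0
  rw [mem_filter] at hσ ⊢
  exact ⟨hσ.1, hσ.2.away 0⟩

end Counting

theorem prod_range_div_factorial (d m : ℕ) (hd : 0 < d) :
    ((∏ t ∈ range (d * m), (t + if d ∣ t then 1 else 0) : ℕ) : ℝ) / (d * m).factorial =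
      ∏ j ∈ range m, ((j + 1 / d) / (j + 1) : ℝ) := by
  induction m with
  | zero => simp
  | succ m ih =>
    rw [prod_range_succ, ← ih]
    obtain ⟨e, rfl⟩ : ∃ e, d = e + 1 := ⟨d - 1, by omega⟩
    have h1 : ∏ i ∈ range (e + 1), ((e + 1) * m + i + if e + 1 ∣ (e + 1) * m + i then 1 else 0) =
        (∏ i ∈ range e, ((e + 1) * m + 1 + i)) * ((e + 1) * m + 1) := by
      rw [prod_range_succ']
      congr 1
      · refine prod_congr rfl fun i hi => ?_
        have : ¬ (e + 1 ∣ (e + 1) * m + (i + 1)) := by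
          rw [Nat.dvd_add_right (dvd_mul_right _ _)]
          intro h
          have := Nat.le_of_dvd (by omega) h
          have := mem_range.1 hi
          omega
        rw [if_neg this]
        ring
      · simp
    have h2 : ((e + 1) * (m + 1)).factorial = ((e + 1) * m).factorial *
        ((∏ i ∈ range e, ((e + 1) * m + 1 + i)) * ((e + 1) * (m + 1))) := by
      rw [mul_add, mul_one, ← Nat.factorial_mul_ascFactorial, Nat.ascFactorial_eq_prod_range,
        prod_range_succ]
      congr 2
      ring
    have h3 : (∏ i ∈ range e, ((e + 1) * m + 1 + i)) ≠ 0 :=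
      prod_ne_zero_iff.2 fun i _ => by omega
    rw [h2, mul_add, mul_one, prod_range_add, h1]
    have h4 := Nat.factorial_ne_zero ((e + 1) * m)
    have h5 : (m : ℝ) + 1 ≠ 0 := by positivity
    have h6 : (e : ℝ) + 1 ≠ 0 := by positivity
    rw [← Nat.cast_ne_zero (R := ℝ)] at h3 h4
    push_cast at h3 ⊢
    field_simp

theorem prod_range_le_rpow {s : ℝ} (hs : 0 < s) (hs1 : s ≤ 1) (m : ℕ) :
    ∏ j ∈ range m, ((j + s) / (j + 1) : ℝ) ≤ (s / (m + s)) ^ (1 - s) := by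
  induction m with
  | zero => simp [hs.ne']
  | succ m ih =>
    rw [prod_range_succ]
    have hm : (0 : ℝ) < m + s := by positivity
    have hm1 : (0 : ℝ) < m + 1 + s := by positivity
    have amgm := Real.geom_mean_le_arith_mean2_weighted hs.le (sub_nonneg.2 hs1) hm.le hm1.le
      (by ring)
    have h1 : s * (m + s) + (1 - s) * (m + 1 + s) = m + 1 := by ring
    rw [h1] at amgm
    have h2 : (m + s : ℝ) = (m + s) ^ s * (m + s) ^ (1 - s) := by
      rw [← Real.rpow_add hm]; simp
    calc _ ≤ (s / (m + s)) ^ (1 - s) * ((m + s) / (m + 1)) := by gcongr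
      _ ≤ _ := by
        push_cast
        rw [Real.div_rpow hs.le hm.le, Real.div_rpow hs.le hm1.le, div_mul_div_comm,
          div_le_div_iff₀ (by positivity) (by positivity)]
        calc _ = s ^ (1 - s) * ((m + s) ^ (1 - s)) * ((m + s) ^ s * (m + 1 + s) ^ (1 - s)) := by
              nth_rewrite 1 [h2]; ring
          _ ≤ s ^ (1 - s) * ((m + s) ^ (1 - s)) * (m + 1) := by gcongr
          _ = _ := by ring

open Classical in
theorem card_isGraded_div_factorial_le (d k : ℕ) (hd : 0 < d) (hk : 0 < k) :
    (#{σ : Perm (Fin k) | IsGraded d σ} : ℝ) / k.factorial ≤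
      (k : ℝ) ^ (-1 + 1 / (d : ℝ) : ℝ) := by
  by_cases hdk : d ∣ k
  · obtain ⟨m, rfl⟩ := hdk
    have hm : 0 < m := Nat.pos_of_mul_pos_left hk
    have hd' : (0 : ℝ) < d := by exact_mod_cast hd
    have hm' : (0 : ℝ) < m := by exact_mod_cast hm
    have hs1 : (1 : ℝ) / d ≤ 1 := by
      rw [div_le_one hd']
      exact_mod_cast hd
    calc _ ≤ ((∏ t ∈ range (d * m), (t + if d ∣ t then 1 else 0) : ℕ) : ℝ) /
            (d * m).factorial := by
          gcongr
          exact card_isGraded_le d _ hk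
      _ ≤ ((1 / d) / (m + 1 / d) : ℝ) ^ (1 - 1 / d : ℝ) := by
          rw [prod_range_div_factorial d m hd]
          exact prod_range_le_rpow (by positivity) hs1 m
      _ ≤ ((d * m : ℝ)⁻¹) ^ (1 - 1 / d : ℝ) := by
          refine Real.rpow_le_rpow (by positivity) ?_ (sub_nonneg.2 hs1)
          rw [div_le_iff₀ (by positivity)]
          field_simp
          linarith
      _ = _ := by
          rw [Real.inv_rpow (by positivity), ← Real.rpow_neg (by positivity)]
          push_cast
          congr 1
          ring
  · have : ({σ : Perm (Fin k) | IsGraded d σ} : Finset (Perm (Fin k))) = ∅ := by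
      refine filter_eq_empty_iff.2 fun σ _ h => hdk ?_
      simpa using h.dvd_card
    rw [this]
    simp
    positivity

theorem exists_grading_of_dvd_minimalPeriod {α : Type*} (d : ℕ) (π : Perm α) :
    ∃ f : α → ZMod d, ∀ x, d ∣ Function.minimalPeriod π x → f (π x) = f x + 1 := by
  let rep : α → α := fun x => (Quotient.mk (Perm.SameCycle.setoid π) x).out
  have hrep : ∀ x, π.SameCycle (rep x) x := fun x => Quotient.mk_out (s := Perm.SameCycle.setoid π) x
  have hrep' : ∀ x, rep (π x) = rep x := fun x => by
    have : Quotient.mk (Perm.SameCycle.setoid π) (π x) = Quotient.mk (Perm.SameCycle.setoid π) x :=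
      Quotient.sound (s := Perm.SameCycle.setoid π)
        (show π.SameCycle (π x) x from Perm.sameCycle_apply_left.2 (Perm.SameCycle.refl _ _))
    simp only [rep, this]
  choose j hj using hrep
  refine ⟨fun x => (j x : ZMod d), fun x hx => ?_⟩
  have h1 : (π ^ (j (π x) - j x - 1)) x = x := by
    have h2 := hj (π x)
    rw [hrep'] at h2
    have h3 : (π ^ (-1 + j (π x) - j x)) x = x := by
      rw [zpow_sub, zpow_add, Perm.mul_apply, Perm.mul_apply]
      have : (π ^ j x)⁻¹ x = rep x := by
        rw [Perm.inv_eq_iff_eq, hj]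
      rw [this, h2]
      simp
    rwa [show j (π x) - j x - 1 = -1 + j (π x) - j x by ring]
  have h2 : (Function.minimalPeriod π x : ℤ) ∣ j (π x) - j x - 1 :=
    MulAction.zpow_smul_eq_iff_minimalPeriod_dvd (a := π) (b := x) |>.1 h1
  have h3 : ((j (π x) - j x - 1 : ℤ) : ZMod d) = 0 :=
    (ZMod.intCast_zmod_eq_zero_iff_dvd _ _).2 ((Int.natCast_dvd_natCast.2 hx).trans h2)
  push_cast at h3
  linear_combination h3

theorem exists_sigma_conj {n m : ℕ} {k d : Fin m → ℕ} (hsum : ∑ i, k i = n)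
    {π : Perm (Fin n)} {A : Fin m → Finset (Fin n)}
    (hdisj : ∀ i j, i ≠ j → Disjoint (A i) (A j)) (hcard : ∀ i, (A i).card = k i)
    (hinv : ∀ i, ∀ x ∈ A i, π x ∈ A i)
    (hdvd : ∀ i, ∀ x ∈ A i, d i ∣ Function.minimalPeriod (⇑π) x) :
    ∃ (e : (Σ i, Fin (k i)) ≃ Fin n) (σ : ∀ i, Perm (Fin (k i))),
      (∀ i, IsGraded (d i) (σ i)) ∧ π = e.permCongr (Perm.sigmaCongrRight σ) := by
  let c : ∀ i, Fin (k i) ≃ A i := fun i => ((A i).equivFinOfCardEq (hcard i)).symm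
  have hinj : Function.Injective fun p : Σ i, Fin (k i) => (c p.1 p.2 : Fin n) := by
    rintro ⟨i, a⟩ ⟨j, b⟩ h
    dsimp only at h
    obtain rfl : i = j := by
      by_contra hij
      exact Finset.disjoint_left.1 (hdisj i j hij) (c i a).2 (h ▸ (c j b).2)
    rw [(c i).injective (Subtype.ext h)]
  let e : (Σ i, Fin (k i)) ≃ Fin n := Equiv.ofBijective _
    ((Fintype.bijective_iff_injective_and_card _).2 ⟨hinj, by simp [hsum]⟩)
  let ρ : ∀ i, Perm (A i) := fun i => π.subtypePermOfFintype (p := (· ∈ A i)) (hinv i)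
  refine ⟨e, fun i => (c i).symm.permCongr (ρ i), fun i => IsGraded.permCongr ?_ _, ?_⟩
  · obtain ⟨f, hf⟩ := exists_grading_of_dvd_minimalPeriod (d i) π
    exact ⟨fun x => f x, fun x => hf x (hdvd i x x.2)⟩
  · ext x
    obtain ⟨⟨i, a⟩, rfl⟩ := e.surjective x
    have he : ∀ p, e p = c p.1 p.2 := fun _ => rfl
    have hs : e.symm (c i a) = ⟨i, a⟩ := e.symm_apply_apply ⟨i, a⟩
    simp [Equiv.permCongr_apply, he, hs, ρ]

theorem stmt_5 (n m : ℕ) (k d : Fin m → ℕ) (hsum : ∑ i, k i = n)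
    (hk : ∀ i, 0 < k i) (hd : ∀ i, 0 < d i) :
    iProp n m k d ≤ ∏ i, (k i : ℝ) ^ (-1 + 1 / (d i : ℝ) : ℝ) := by
  classical
  set P : Perm (Fin n) → Prop := fun π => ∃ A : Fin m → Finset (Fin n),
    (∀ i j, i ≠ j → Disjoint (A i) (A j)) ∧ (∀ i, (A i).card = k i) ∧
    (∀ i, ∀ x ∈ A i, π x ∈ A i) ∧
    (∀ i, ∀ x ∈ A i, d i ∣ Function.minimalPeriod (⇑π) x) with hP
  have key : ∀ π : {π // P π}, ∃ (e : (Σ i, Fin (k i)) ≃ Fin n) (σ : ∀ i, Perm (Fin (k i))),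
      (∀ i, IsGraded (d i) (σ i)) ∧ π.1 = e.permCongr (Perm.sigmaCongrRight σ) := by
    rintro ⟨π, A, h1, h2, h3, h4⟩
    exact exists_sigma_conj hsum h1 h2 h3 h4
  choose e σ hσ hπ using key
  let Φ : {π // P π} × (∀ i, Perm (Fin (k i))) →
      ((Σ i, Fin (k i)) ≃ Fin n) × (∀ i, {τ : Perm (Fin (k i)) // IsGraded (d i) τ}) :=
    fun p => ((Perm.sigmaCongrRight p.2).trans (e p.1),
      fun i => ⟨(p.2 i).symm.permCongr (σ p.1 i), (hσ p.1 i).permCongr _⟩)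
  have hrec : ∀ p, p.1.1 = (Φ p).1.permCongr (Perm.sigmaCongrRight fun i => ((Φ p).2 i).1) := by
    intro p
    rw [hπ]
    ext x
    simp [Φ, Equiv.permCongr_apply]
  have hinj : Function.Injective Φ := by
    rintro ⟨π, τ⟩ ⟨π', τ'⟩ h
    obtain rfl : π = π' := Subtype.ext (by
      have h1 := hrec (π, τ)
      rw [h] at h1
      exact h1.trans (hrec (π', τ')).symm)
    have h1 := congrArg Prod.fst h
    have h2 : Perm.sigmaCongrRight τ = Perm.sigmaCongrRight τ' := by
      ext1 x
      simpa [Φ] using Equiv.congr_fun h1 x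
    rw [Perm.sigmaCongrRightHom_injective h2]
  have hcount : Nat.card {π // P π} * ∏ i, (k i).factorial ≤
      n.factorial * ∏ i, #{τ : Perm (Fin (k i)) | IsGraded (d i) τ} := by
    have := Nat.card_le_card_of_injective Φ hinj
    have e0 : (Σ i, Fin (k i)) ≃ Fin n := Fintype.equivOfCardEq (by simp [hsum])
    have he : Fintype.card ((Σ i, Fin (k i)) ≃ Fin n) = n.factorial := by
      rw [Fintype.card_equiv e0]; simp [hsum]
    rw [Nat.card_prod, Nat.card_prod, Nat.card_pi, Nat.card_pi, Nat.card_eq_fintype_card (α := _ ≃ _),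
      he] at this
    simpa [Fintype.card_perm, Fintype.card_subtype] using this
  calc iProp n m k d = (Nat.card {π // P π} : ℝ) / n.factorial := rfl
    _ ≤ ∏ i, (#{τ : Perm (Fin (k i)) | IsGraded (d i) τ} : ℝ) / (k i).factorial := by
        rw [prod_div_distrib, div_le_div_iff₀ (by positivity)
          (prod_pos fun i _ => by positivity), mul_comm (∏ i, _)]
        exact_mod_cast hcount
    _ ≤ _ := prod_le_prod (fun i _ => by positivity)
        fun i _ => card_isGraded_div_factorial_le (d i) (k i) (hd i) (hk i)
end

section
/- Fix d ≥ 3. Suppose k_1, k_2 ≥ 1 with d dividing k_1 and n = k_1 + k_2. Let i(n, (k_1,k_2), (d,1)) be the proportion of π ∈ S_n admitting disjoint invariant sets A_1, A_2 with |A_1| = k_1, |A_2| = k_2 and all cycles of π|_{A_1} of length divisible by d. Then there exist constants c_1(d), c_2(d) > 0 with c_1(d)·k_1^{-1+1/d} ≤ i(n, (k_1,k_2), (d,1)) ≤ c_2(d)·k_1^{-1+1/d}. -/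
open Function Equiv

/-- The number of permutations of `n` points all of whose cycles have length divisible by `d`. -/
noncomputable def permCount (d n : ℕ) : ℕ :=
  Nat.card {π : Perm (Fin n) // ∀ x, d ∣ minimalPeriod π x}

lemma minimalPeriod_eq_of_injective_semiconj {α β : Type*} {f : α → α} {g : β → β} {h : α → β}
    (hh : Injective h) (hc : Semiconj h f g) (x : α) :
    minimalPeriod g (h x) = minimalPeriod f x := by
  rw [minimalPeriod_eq_minimalPeriod_iff]
  intro n
  simp only [IsPeriodicPt, IsFixedPt]
  rw [← (hc.iterate_right n).eq x, hh.eq_iff]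

lemma card_perm_dvd_minimalPeriod (d : ℕ) (α : Type*) [Fintype α] :
    Nat.card {π : Perm α // ∀ x, d ∣ minimalPeriod π x} = permCount d (Fintype.card α) := by
  let e := Fintype.equivFin α
  refine Nat.card_congr (e.permCongr.subtypeEquiv fun π => ?_)
  have hc : Semiconj e π (e.permCongr π) := fun x => by simp
  rw [← e.forall_congr_right]
  exact forall_congr' fun x => by rw [minimalPeriod_eq_of_injective_semiconj e.injective hc]

lemma permCount_one (n : ℕ) : permCount 1 n = n.factorial := by
  have e : {π : Perm (Fin n) // ∀ x, 1 ∣ minimalPeriod π x} ≃ Perm (Fin n) :=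
    Equiv.subtypeUnivEquiv fun π x => one_dvd _
  rw [permCount, Nat.card_congr e, Nat.card_eq_fintype_card, Fintype.card_perm, Fintype.card_fin]

lemma card_perm_fiber {α ι : Type*} [Fintype α] [Fintype ι] [DecidableEq ι]
    (f : α → ι) (e : ι → ℕ) :
    Nat.card {π : Perm α // (∀ x, f (π x) = f x) ∧ ∀ x, e (f x) ∣ minimalPeriod π x} =
      ∏ i, permCount (e i) (Fintype.card {a // f a = i}) := by
  simp_rw [← card_perm_dvd_minimalPeriod, ← Nat.card_pi]
  refine Nat.card_congr
    { toFun := fun π i => ⟨π.1.subtypePerm fun a => by rw [π.2.1], fun x => ?_⟩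
      invFun := fun g => ⟨DomMulAct.stabilizerEquiv_invFun_aux fun i => (g i).1,
        fun x => DomMulAct.comp_stabilizerEquiv_invFun (fun i => (g i).1) x, fun x => ?_⟩
      left_inv := fun π => ?_
      right_inv := fun g => ?_ }
  · have h := π.2.2 x.1
    rw [x.2] at h
    rwa [← minimalPeriod_eq_of_injective_semiconj Subtype.val_injective
      (g := (π.1 : α → α)) (fun y => rfl)]
  · have h := (g (f x)).2 ⟨x, rfl⟩
    rwa [← minimalPeriod_eq_of_injective_semiconj Subtype.val_injective
      (g := DomMulAct.stabilizerEquiv_invFun_aux fun i => (g i).1)] at h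
    intro y
    exact (DomMulAct.stabilizerEquiv_invFun_eq (fun i => (g i).1) y.2).symm
  · ext x
    rfl
  · ext i x
    exact DomMulAct.stabilizerEquiv_invFun_eq (fun i => (g i).1) x.2

/-- A labelling by `ZMod d` that increases by one along each step of `π`, corrected by `r` at the
steps which arrive at `b`, exists. For finite types this says that the cycle of `b` has length
congruent to `r` modulo `d`, and all other cycles have length divisible by `d`. -/
def HasLabelling {α : Type*} [DecidableEq α] {d : ℕ} (r : ZMod d) (b : α) (π : Perm α) : Prop :=
  ∃ f : α → ZMod d, ∀ y, f (π y) + (if π y = b then r else 0) = f y + 1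

lemma exists_labelling_iff {α : Type*} (d : ℕ) (π : Perm α) :
    (∃ f : α → ZMod d, ∀ y, f (π y) = f y + 1) ↔ ∀ x, d ∣ minimalPeriod π x := by
  constructor
  · rintro ⟨f, hf⟩ x
    have h (n : ℕ) : f (π^[n] x) = f x + n := by
      induction n with
      | zero => simp
      | succ n ih => rw [iterate_succ_apply', hf, ih]; push_cast; ring
    have := h (minimalPeriod π x)
    rwa [iterate_minimalPeriod, left_eq_add, ZMod.natCast_eq_zero_iff] at this
  · intro h
    let s := Perm.SameCycle.setoid π
    have hrep (y : α) : ∃ i : ℤ, (π ^ i) (Quotient.mk s y).out = y :=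
      Quotient.exact (Quotient.out_eq (Quotient.mk s y))
    choose i hi using hrep
    refine ⟨fun y => i y, fun y => ?_⟩
    have hq : Quotient.mk s (π y) = Quotient.mk s y :=
      Quotient.sound (Perm.sameCycle_apply_left.2 (Perm.SameCycle.refl π y))
    set z := (Quotient.mk s y).out with hz
    have h1 : (π ^ (i (π y))) z = (π ^ (i y + 1)) z := by
      have := hi (π y)
      rw [hq] at this
      rw [this, add_comm, zpow_add, Perm.mul_apply, hi y, zpow_one]
    have h2 : π ^ (i (π y) - (i y + 1)) • z = z := by
      rw [sub_eq_neg_add, zpow_add, mul_smul, Perm.smul_def, Perm.smul_def, h1,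
        ← Perm.mul_apply, ← zpow_add, neg_add_cancel, zpow_zero, Perm.one_apply]
    rw [MulAction.zpow_smul_eq_iff_minimalPeriod_dvd] at h2
    have h3 : (d : ℤ) ∣ i (π y) - (i y + 1) :=
      (Int.natCast_dvd_natCast.2 (h z)).trans h2
    rw [← ZMod.intCast_zmod_eq_zero_iff_dvd] at h3
    push_cast at h3
    exact sub_eq_zero.1 h3

lemma hasLabelling_zero_iff {α : Type*} [DecidableEq α] {d : ℕ} (b : α) (π : Perm α) :
    HasLabelling (0 : ZMod d) b π ↔ ∀ x, d ∣ minimalPeriod π x := by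
  rw [← exists_labelling_iff]
  simp [HasLabelling]

lemma hasLabelling_optionCongr {α : Type*} [DecidableEq α] {d : ℕ} (r : ZMod d) (π : Perm α) :
    HasLabelling r none (optionCongr π) ↔ r = 1 ∧ ∀ x, d ∣ minimalPeriod π x := by
  rw [← exists_labelling_iff]
  constructor
  · rintro ⟨f, hf⟩
    exact ⟨by simpa using hf none, fun x => f (some x), fun y => by simpa using hf (some y)⟩
  · rintro ⟨rfl, f, hf⟩
    refine ⟨fun x => x.elim 0 f, fun y => ?_⟩
    cases y <;> simp [hf]

lemma hasLabelling_swap_mul_optionCongr {α : Type*} [DecidableEq α] {d : ℕ} (r : ZMod d)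
    (x : α) (π : Perm α) :
    HasLabelling r none (swap none (some x) * optionCongr π) ↔ HasLabelling (r - 1) x π := by
  constructor
  · rintro ⟨f, hf⟩
    refine ⟨fun y => f (some y), fun y => ?_⟩
    have h0 := hf none
    have h1 := hf (some y)
    by_cases hy : π y = x
    · simp [hy] at h0 h1 ⊢
      linear_combination h0 + h1
    · simpa [hy, swap_apply_of_ne_of_ne] using h1
  · rintro ⟨f, hf⟩
    refine ⟨fun y => y.elim (f x - 1) f, fun y => ?_⟩
    cases y with
    | none => simp
    | some y =>
      have h1 := hf y
      by_cases hy : π y = x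
      · simp [hy] at h1 ⊢
        linear_combination h1
      · simpa [hy, swap_apply_of_ne_of_ne] using h1

/-- The number of permutations of a set of `n + 1` points admitting a labelling with correction `r`
at a marked point. -/
noncomputable def markedCount {d : ℕ} (r : ZMod d) (n : ℕ) : ℕ :=
  Nat.card {π : Perm (Option (Fin n)) // HasLabelling r none π}

lemma card_hasLabelling {α : Type*} [Fintype α] [DecidableEq α] {d n : ℕ} (r : ZMod d) (b : α)
    (h : Fintype.card α = n + 1) :
    Nat.card {π : Perm α // HasLabelling r b π} = markedCount r n := by
  obtain ⟨e, he⟩ : ∃ e : α ≃ Option (Fin n), e b = none := by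
    have e : α ≃ Option (Fin n) := Fintype.equivOfCardEq (by simp [h])
    exact ⟨e.trans (swap (e b) none), by simp⟩
  refine Nat.card_congr (e.permCongr.subtypeEquiv fun π => ?_)
  constructor
  · rintro ⟨f, hf⟩
    refine ⟨f ∘ e.symm, fun y => ?_⟩
    have := hf (e.symm y)
    simpa [← he] using this
  · rintro ⟨f, hf⟩
    refine ⟨f ∘ e, fun y => ?_⟩
    have := hf (e y)
    simpa [← he] using this

lemma markedCount_eq {d : ℕ} (r : ZMod d) (n : ℕ) :
    markedCount r n = (if r = 1 then permCount d n else 0) + n * markedCount (r - 1) (n - 1) := by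
  have h1 : markedCount r n = ∑ x : Option (Fin n), Nat.card {π : Perm (Fin n) //
      HasLabelling r none (swap none x * optionCongr π)} := by
    rw [← Nat.card_sigma, markedCount]
    refine Nat.card_congr (Equiv.trans ?_ (Equiv.subtypeProdEquivSigmaSubtype
      fun (x : Option (Fin n)) (π : Perm (Fin n)) =>
        HasLabelling r none (swap none x * optionCongr π)))
    refine Perm.decomposeOption.subtypeEquiv fun π => ?_
    rw [← Perm.decomposeOption_symm_apply, Equiv.symm_apply_apply]
  rw [h1, Fintype.sum_option]
  congr 1
  · simp_rw [swap_self, ← Perm.one_def, one_mul, hasLabelling_optionCongr]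
    split_ifs with hr
    · simp [hr, permCount]
    · simp [hr]
  · simp_rw [hasLabelling_swap_mul_optionCongr]
    rcases n with _ | n
    · simp
    · rw [Finset.sum_congr rfl fun x _ => card_hasLabelling (n := n) (r - 1) x (by simp)]
      simp

lemma permCount_zero (d : ℕ) : permCount d 0 = 1 := by
  simp [permCount]

lemma permCount_succ (d n : ℕ) : permCount d (n + 1) = markedCount (0 : ZMod d) n := by
  rw [← card_hasLabelling (α := Fin (n + 1)) (0 : ZMod d) 0 (by simp)]
  simp_rw [hasLabelling_zero_iff, permCount]

lemma markedCount_zero_eq_descFactorial_mul {d : ℕ} (n j : ℕ) (hj : j < d) :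
    markedCount (0 : ZMod d) n = n.descFactorial j * markedCount (-j : ZMod d) (n - j) := by
  induction j with
  | zero => simp
  | succ j ih =>
    have h1 : (-j : ZMod d) ≠ 1 := by
      intro h
      have : ((j + 1 : ℕ) : ZMod d) = 0 := by push_cast; linear_combination -h
      rw [ZMod.natCast_eq_zero_iff] at this
      exact absurd (Nat.le_of_dvd j.succ_pos this) (by omega)
    rw [ih (by omega), markedCount_eq, if_neg h1, Nat.descFactorial_succ, Nat.sub_sub]
    push_cast
    ring_nf

lemma permCount_eq_zero_of_lt {d n : ℕ} (hn : 0 < n) (h : n < d) : permCount d n = 0 := by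
  obtain ⟨n, rfl⟩ := Nat.exists_eq_succ_of_ne_zero hn.ne'
  rw [permCount_succ, markedCount_zero_eq_descFactorial_mul n (d - 1) (by omega),
    Nat.descFactorial_eq_zero_iff_lt.2 (by omega), zero_mul]

lemma permCount_add {d : ℕ} (hd : 0 < d) (n : ℕ) :
    permCount d (n + d) = (n + d - 1).descFactorial (d - 1) * ((n + 1) * permCount d n) := by
  have h1 : (-((d - 1 : ℕ) : ZMod d)) = 1 := by
    rw [Nat.cast_sub hd]; simp
  have h2 : n + d = (n + d - 1) + 1 := by omega
  rw [h2, permCount_succ, markedCount_zero_eq_descFactorial_mul _ (d - 1) (by omega),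
    Nat.add_sub_cancel, show n + d - 1 - (d - 1) = n by omega, h1, markedCount_eq, if_pos rfl]
  congr 1
  rcases n with _ | n
  · simp
  · rw [sub_self, Nat.add_sub_cancel, ← permCount_succ]
    ring

/-- The proportion of permutations of `n` points all of whose cycles have length divisible
by `d`. -/
noncomputable def permProp (d n : ℕ) : ℝ := permCount d n / n.factorial

lemma permProp_zero (d : ℕ) : permProp d 0 = 1 := by
  simp [permProp, permCount_zero]

lemma permProp_nonneg (d n : ℕ) : 0 ≤ permProp d n := by
  unfold permProp; positivity

lemma permCount_eq (d n : ℕ) : (permCount d n : ℝ) = n.factorial * permProp d n := by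
  unfold permProp; field_simp

lemma permProp_add {d : ℕ} (hd : 0 < d) (n : ℕ) :
    permProp d (n + d) = (n + 1) / (n + d) * permProp d n := by
  have h1 : n.factorial * (n + d - 1).descFactorial (d - 1) = (n + d - 1).factorial := by
    have := Nat.factorial_mul_descFactorial (n := n + d - 1) (k := d - 1) (by omega)
    rwa [show n + d - 1 - (d - 1) = n by omega] at this
  have h2 : (n + d).factorial = (n + d) * (n + d - 1).factorial :=
    (Nat.mul_factorial_pred (by omega)).symm
  have h3 : ((n + d - 1).descFactorial (d - 1) : ℝ) ≠ 0 := by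
    rw [Nat.cast_ne_zero, Ne, Nat.descFactorial_eq_zero_iff_lt]
    omega
  have h4 : ((n : ℝ) + d) ≠ 0 := by positivity
  rw [permProp, permProp, permCount_add hd, h2, ← h1]
  push_cast
  field_simp

lemma permProp_eq_zero {d : ℕ} (hd : 0 < d) (n : ℕ) (h : ¬ d ∣ n) : permProp d n = 0 := by
  induction n using Nat.strong_induction_on with
  | _ n ih =>
    rcases lt_or_ge n d with hn | hn
    · have : 0 < n := Nat.pos_of_ne_zero fun h0 => h (h0 ▸ dvd_zero d)
      rw [permProp, permCount_eq_zero_of_lt this hn]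
      simp
    · obtain ⟨m, rfl⟩ := Nat.exists_eq_add_of_le' hn
      rw [permProp_add hd, ih m (by omega) (fun hm => h (hm.add (dvd_refl d))), mul_zero]

/-- The set `A` is invariant under `π`, and all cycles of `π` in `A` have length divisible
by `d`. -/
def IsDvdInvariant {α : Type*} (d : ℕ) (A : Finset α) (π : Perm α) : Prop :=
  (∀ x ∈ A, π x ∈ A) ∧ ∀ x ∈ A, d ∣ minimalPeriod π x

lemma apply_mem_iff_of_mapsTo {α : Type*} {A : Finset α} {π : Perm α} (h : ∀ x ∈ A, π x ∈ A)
    (x : α) : π x ∈ A ↔ x ∈ A := by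
  refine ⟨fun hx => ?_, h x⟩
  simpa using Perm.perm_symm_on_of_perm_on_finset h hx

open Classical in
/-- The number of invariant sets of size `k` in which all cycles have length divisible by `d`. -/
noncomputable def invariantCount {α : Type*} [Fintype α] (d k : ℕ) (π : Perm α) : ℕ :=
  ((Finset.powersetCard k (Finset.univ : Finset α)).filter (IsDvdInvariant d · π)).card

lemma invariantCount_pos_iff {α : Type*} [Fintype α] (d k : ℕ) (π : Perm α) :
    0 < invariantCount d k π ↔ ∃ A : Finset α, A.card = k ∧ IsDvdInvariant d A π := by
  classical
  rw [invariantCount, Finset.card_pos]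
  simp [Finset.Nonempty, Finset.mem_powersetCard]

section Moments

variable {α : Type*} [Fintype α] [DecidableEq α]

lemma card_isDvdInvariant (d : ℕ) (A : Finset α) :
    Nat.card {π : Perm α // IsDvdInvariant d A π} =
      permCount d A.card * (Fintype.card α - A.card).factorial := by
  have h := card_perm_fiber (fun x => decide (x ∈ A)) (fun b => if b then d else 1)
  have h1 : Fintype.card {x // x ∈ A} = A.card := by simp
  have h2 : Fintype.card {x // x ∉ A} = Fintype.card α - A.card := by
    simp [Fintype.card_subtype_compl]
  simp only [Fintype.prod_bool, decide_eq_true_eq, decide_eq_false_iff_not, if_true,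
    Bool.false_eq_true, if_false, permCount_one, h1, h2] at h
  rw [← h]
  refine Nat.card_congr (Equiv.subtypeEquivRight fun π => ?_)
  refine ⟨fun hA => ⟨fun x => ?_, fun x => ?_⟩, fun hA => ⟨fun x hx => ?_, fun x hx => ?_⟩⟩
  · simp [apply_mem_iff_of_mapsTo hA.1]
  · split_ifs with hx
    · exact hA.2 x hx
    · exact one_dvd _
  · simpa [hx] using hA.1 x
  · simpa [hx] using hA.2 x

lemma card_isDvdInvariant_and (d : ℕ) (A B : Finset α) :
    Nat.card {π : Perm α // IsDvdInvariant d A π ∧ IsDvdInvariant d B π} =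
      permCount d (A ∩ B).card * permCount d (A \ B).card * (permCount d (B \ A).card *
        (Fintype.card α - (A ∪ B).card).factorial) := by
  have h := card_perm_fiber (fun x => (decide (x ∈ A), decide (x ∈ B)))
    (fun b => if b.1 ∨ b.2 then d else 1)
  have h1 : Fintype.card {x // x ∈ A ∧ x ∈ B} = (A ∩ B).card :=
    Fintype.card_of_subtype _ (by simp)
  have h2 : Fintype.card {x // x ∈ A ∧ x ∉ B} = (A \ B).card :=
    Fintype.card_of_subtype _ (by simp)
  have h3 : Fintype.card {x // x ∉ A ∧ x ∈ B} = (B \ A).card :=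
    Fintype.card_of_subtype _ (by simp [and_comm])
  have h4 : Fintype.card {x // x ∉ A ∧ x ∉ B} = Fintype.card α - (A ∪ B).card := by
    rw [← Finset.card_compl]
    exact Fintype.card_of_subtype _ (by simp)
  simp only [Fintype.prod_prod_type, Fintype.prod_bool, Prod.mk.injEq, decide_eq_true_eq,
    decide_eq_false_iff_not, true_or, or_true, or_self, if_true,
    Bool.false_eq_true, if_false, permCount_one, h1, h2, h3, h4] at h
  rw [← h]
  refine Nat.card_congr (Equiv.subtypeEquivRight fun π => ?_)
  constructor
  · rintro ⟨hA, hB⟩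
    refine ⟨fun x => ?_, fun x => ?_⟩
    · simp [apply_mem_iff_of_mapsTo hA.1, apply_mem_iff_of_mapsTo hB.1]
    · split_ifs with hx
      · exact hx.elim (hA.2 x) (hB.2 x)
      · exact one_dvd _
  · rintro ⟨hf, hd⟩
    simp only [decide_eq_decide] at hf
    exact ⟨⟨fun x hx => (hf x).1.2 hx, fun x hx => by simpa [hx] using hd x⟩,
      ⟨fun x hx => (hf x).2.2 hx, fun x hx => by simpa [hx] using hd x⟩⟩

lemma sum_invariantCount (d k : ℕ) (hk : k ≤ Fintype.card α) :
    (∑ π : Perm α, (invariantCount d k π : ℝ)) = (Fintype.card α).factorial * permProp d k := by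
  classical
  simp_rw [invariantCount, Finset.card_filter]
  push_cast
  rw [Finset.sum_comm]
  have h (A) (hA : A ∈ Finset.powersetCard k (Finset.univ : Finset α)) :
      ∑ π : Perm α, (if IsDvdInvariant d A π then (1 : ℝ) else 0) =
        k.factorial * permProp d k * (Fintype.card α - k).factorial := by
    rw [← permCount_eq, Finset.sum_boole, ← Fintype.card_subtype, ← Nat.card_eq_fintype_card,
      card_isDvdInvariant, (Finset.mem_powersetCard.1 hA).2]
    push_cast
    rfl
  rw [Finset.sum_congr rfl h, Finset.sum_const, Finset.card_powersetCard, Finset.card_univ,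
    ← Nat.choose_mul_factorial_mul_factorial hk]
  push_cast
  ring

lemma card_filter_card_inter_le (A : Finset α) (k j : ℕ) :
    ((Finset.powersetCard k (Finset.univ : Finset α)).filter
      (fun B => (A ∩ B).card = j)).card ≤
      A.card.choose j * (Fintype.card α - A.card).choose (k - j) := by
  rw [← Finset.card_compl, ← Finset.card_powersetCard, ← Finset.card_powersetCard,
    ← Finset.card_product]
  refine Finset.card_le_card_of_injOn (fun B => (A ∩ B, B \ A)) ?_ ?_
  · intro B hB
    simp only [Finset.coe_filter, Finset.mem_powersetCard, Finset.subset_univ, true_and,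
      Set.mem_ofPred_eq] at hB
    have := Finset.card_inter_add_card_sdiff B A
    rw [Finset.inter_comm] at this
    simp only [Finset.coe_product, Set.mem_prod, Finset.mem_coe, Finset.mem_powersetCard]
    refine ⟨⟨Finset.inter_subset_left, hB.2⟩, fun x hx => ?_, by omega⟩
    simpa using (Finset.mem_sdiff.1 hx).2
  · intro B _ C _ h
    simp only [Prod.mk.injEq] at h
    rw [← Finset.sdiff_union_inter B A, ← Finset.sdiff_union_inter C A, h.2,
      Finset.inter_comm, h.1, Finset.inter_comm]

lemma choose_mul_factorial_mul_factorial_le (n k : ℕ) :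
    n.choose k * k.factorial * (n - k).factorial ≤ n.factorial := by
  rcases le_or_gt k n with h | h
  · exact (Nat.choose_mul_factorial_mul_factorial h).le
  · simp [Nat.choose_eq_zero_of_lt h]

lemma sum_card_isDvdInvariant_and_le (d k : ℕ) (A : Finset α) (hA : A.card = k) :
    ∑ B ∈ Finset.powersetCard k (Finset.univ : Finset α),
      (Nat.card {π : Perm α // IsDvdInvariant d A π ∧ IsDvdInvariant d B π} : ℝ) ≤
      k.factorial * (Fintype.card α - k).factorial *
        ∑ j ∈ Finset.range (k + 1), permProp d j * permProp d (k - j) ^ 2 := by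
  set l := Fintype.card α - k with hl
  have hcount (B) (hB : B ∈ Finset.powersetCard k (Finset.univ : Finset α)) :
      (Nat.card {π : Perm α // IsDvdInvariant d A π ∧ IsDvdInvariant d B π} : ℝ) =
        (fun j => (permCount d j * permCount d (k - j) * (permCount d (k - j) *
          (l - (k - j)).factorial) : ℝ)) (A ∩ B).card := by
    have hB := (Finset.mem_powersetCard.1 hB).2
    have h1 := Finset.card_inter_add_card_sdiff A B
    have h2 := Finset.card_inter_add_card_sdiff B A
    have h3 := Finset.card_union_add_card_inter A B
    rw [Finset.inter_comm] at h2
    rw [card_isDvdInvariant_and, show (A \ B).card = k - (A ∩ B).card by omega,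
      show (B \ A).card = k - (A ∩ B).card by omega,
      show Fintype.card α - (A ∪ B).card = l - (k - (A ∩ B).card) by omega]
    push_cast
    rfl
  rw [Finset.sum_congr rfl hcount, ← Finset.sum_fiberwise_of_maps_to (t := Finset.range (k + 1))
    (g := fun B => (A ∩ B).card)]
  · rw [Finset.mul_sum]
    refine Finset.sum_le_sum fun j hj => ?_
    have hj : j ≤ k := Nat.lt_succ_iff.1 (Finset.mem_range.1 hj)
    rw [Finset.sum_congr rfl fun B hB => by rw [(Finset.mem_filter.1 hB).2], Finset.sum_const,
      nsmul_eq_mul]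
    have h1 : (((Finset.powersetCard k (Finset.univ : Finset α)).filter
        (fun B => (A ∩ B).card = j)).card : ℝ) ≤ k.choose j * l.choose (k - j) := by
      have := card_filter_card_inter_le A k j
      rw [hA] at this
      exact_mod_cast this
    have h2 : (l.choose (k - j) * (k - j).factorial * (l - (k - j)).factorial : ℝ) ≤
        l.factorial := by
      exact_mod_cast choose_mul_factorial_mul_factorial_le l (k - j)
    have h3 : (k.choose j * j.factorial * (k - j).factorial : ℝ) = k.factorial := by
      exact_mod_cast Nat.choose_mul_factorial_mul_factorial hj
    have hp := permProp_nonneg d j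
    calc _ ≤ (k.choose j * l.choose (k - j) : ℝ) * (permCount d j * permCount d (k - j) *
          (permCount d (k - j) * (l - (k - j)).factorial)) := by gcongr
      _ = (k.choose j * j.factorial * (k - j).factorial : ℝ) *
          (permProp d j * permProp d (k - j) ^ 2) *
          (l.choose (k - j) * (k - j).factorial * (l - (k - j)).factorial) := by
        simp_rw [permCount_eq]
        ring
      _ ≤ k.factorial * (permProp d j * permProp d (k - j) ^ 2) * l.factorial := by
        rw [h3]
        gcongr
      _ = _ := by ring
  · intro B _
    rw [Finset.mem_range, Nat.lt_succ_iff, ← hA]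
    exact Finset.card_le_card Finset.inter_subset_left

lemma sum_invariantCount_sq_le (d k : ℕ) (hk : k ≤ Fintype.card α) :
    (∑ π : Perm α, (invariantCount d k π : ℝ) ^ 2) ≤ (Fintype.card α).factorial *
      ∑ j ∈ Finset.range (k + 1), permProp d j * permProp d (k - j) ^ 2 := by
  classical
  have h (π : Perm α) : (invariantCount d k π : ℝ) ^ 2 =
      ∑ A ∈ Finset.powersetCard k (Finset.univ : Finset α),
        ∑ B ∈ Finset.powersetCard k (Finset.univ : Finset α),
          if IsDvdInvariant d A π ∧ IsDvdInvariant d B π then (1 : ℝ) else 0 := by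
    rw [invariantCount, Finset.card_filter, sq]
    push_cast
    rw [Finset.sum_mul_sum]
    simp_rw [ite_and, ite_mul, one_mul, zero_mul]
  simp_rw [h]
  rw [Finset.sum_comm]
  simp_rw [Finset.sum_comm (s := (Finset.univ : Finset (Perm α))), Finset.sum_boole,
    ← Fintype.card_subtype, ← Nat.card_eq_fintype_card]
  refine (Finset.sum_le_sum fun A hA => sum_card_isDvdInvariant_and_le d k A
    (Finset.mem_powersetCard.1 hA).2).trans (le_of_eq ?_)
  rw [Finset.sum_const, Finset.card_powersetCard, Finset.card_univ,
    Nat.card_eq_fintype_card, ← Nat.choose_mul_factorial_mul_factorial hk]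
  push_cast
  ring

lemma card_exists_isDvdInvariant_le (d k : ℕ) (hk : k ≤ Fintype.card α) :
    (Nat.card {π : Perm α // ∃ A : Finset α, A.card = k ∧ IsDvdInvariant d A π} : ℝ) ≤
      (Fintype.card α).factorial * permProp d k := by
  classical
  rw [← sum_invariantCount d k hk, Nat.card_eq_fintype_card, Fintype.card_subtype,
    ← Finset.sum_boole]
  refine Finset.sum_le_sum fun π _ => ?_
  split_ifs with h
  · rw [← invariantCount_pos_iff] at h
    exact_mod_cast h
  · positivity

lemma sq_le_card_exists_isDvdInvariant_mul (d k : ℕ) (hk : k ≤ Fintype.card α) :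
    ((Fintype.card α).factorial * permProp d k) ^ 2 ≤
      (Nat.card {π : Perm α // ∃ A : Finset α, A.card = k ∧ IsDvdInvariant d A π} : ℝ) *
        ((Fintype.card α).factorial *
          ∑ j ∈ Finset.range (k + 1), permProp d j * permProp d (k - j) ^ 2) := by
  classical
  refine le_trans ?_ (mul_le_mul_of_nonneg_left (sum_invariantCount_sq_le d k hk) (by positivity))
  rw [← sum_invariantCount d k hk, Nat.card_eq_fintype_card, Fintype.card_subtype,
    ← Finset.sum_filter_of_ne (p := fun π => ∃ A : Finset α, A.card = k ∧ IsDvdInvariant d A π)]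
  · refine sq_sum_le_card_mul_sum_sq.trans (mul_le_mul_of_nonneg_left ?_ (by positivity))
    exact Finset.sum_le_sum_of_subset_of_nonneg (Finset.subset_univ _) fun _ _ _ => by positivity
  · intro π _ h
    rw [← invariantCount_pos_iff]
    exact Nat.pos_of_ne_zero (by exact_mod_cast h)

end Moments

lemma le_rpow_neg_of_recurrence {t : ℝ} (h0 : 0 < t) (h1 : t < 1) {b : ℕ → ℝ} (hb0 : b 0 = 1)
    (hb : ∀ m : ℕ, b (m + 1) = (1 - t / (m + 1)) * b m) (m : ℕ) :
    b m ≤ ((m : ℝ) + 1) ^ (-t) := by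
  induction m with
  | zero => simp [hb0]
  | succ m ih =>
    have hm : (0 : ℝ) < m + 1 := by positivity
    have hu : t / (m + 1 : ℝ) ≤ 1 := by rw [div_le_one hm]; linarith
    have hB : (1 + 1 / (m + 1 : ℝ)) ^ t ≤ 1 + t * (1 / (m + 1 : ℝ)) :=
      rpow_one_add_le_one_add_mul_self (by have : (0 : ℝ) ≤ 1 / (m + 1) := by positivity
                                           linarith) h0.le h1.le
    have hx : (1 - t / (m + 1 : ℝ)) * (1 + 1 / (m + 1 : ℝ)) ^ t ≤ 1 := by
      refine (mul_le_mul_of_nonneg_left hB (by linarith)).trans ?_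
      rw [mul_one_div]
      nlinarith [sq_nonneg (t / (m + 1 : ℝ))]
    have hs : ((m + 1 : ℕ) : ℝ) + 1 = (m + 1) * (1 + 1 / (m + 1 : ℝ)) := by
      push_cast; field_simp
    rw [hb, hs, Real.mul_rpow (by positivity) (by positivity), mul_comm,
      Real.rpow_neg (by positivity : (0 : ℝ) ≤ 1 + 1 / (m + 1 : ℝ))]
    refine mul_le_mul ih ?_ (by linarith) (by positivity)
    rw [← one_div, le_div_iff₀ (by positivity)]
    exact hx

lemma mul_rpow_neg_le_of_recurrence {t : ℝ} (h0 : 0 < t) (h1 : t < 1) {b : ℕ → ℝ} (hb0 : b 0 = 1)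
    (hb : ∀ m : ℕ, b (m + 1) = (1 - t / (m + 1)) * b m) {m : ℕ} (hm : 1 ≤ m) :
    (1 - t) * (m : ℝ) ^ (-t) ≤ b m := by
  induction m, hm using Nat.le_induction with
  | base => simp [hb0, hb]
  | succ m hm ih =>
    have hm0 : (0 : ℝ) < m := by exact_mod_cast hm
    have hm1 : (0 : ℝ) < m + 1 := by positivity
    have hv : 1 / (m + 1 : ℝ) ≤ 1 := by rw [div_le_one hm1]; linarith
    have hB : (1 + -(1 / (m + 1 : ℝ))) ^ t ≤ 1 + t * -(1 / (m + 1 : ℝ)) :=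
      rpow_one_add_le_one_add_mul_self (by linarith) h0.le h1.le
    have hs : (1 + -(1 / (m + 1 : ℝ))) = m / (m + 1) := by field_simp; ring
    rw [hs, Real.div_rpow hm0.le hm1.le] at hB
    have hs2 : ((m + 1 : ℕ) : ℝ) ^ (-t) = ((m : ℝ) ^ t / (m + 1 : ℝ) ^ t) * (m : ℝ) ^ (-t) := by
      push_cast
      rw [Real.rpow_neg hm0.le, Real.rpow_neg hm1.le]
      have : (m : ℝ) ^ t ≠ 0 := by positivity
      field_simp
    rw [hb, hs2, mul_left_comm]
    refine mul_le_mul (hB.trans (le_of_eq (by ring))) ih ?_ ?_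
    · have : 0 < 1 - t := by linarith
      positivity
    · refine le_trans (by positivity) (hB.trans (le_of_eq (by ring)))

lemma rpow_neg_mul_rpow_neg_sq_le {t x y z : ℝ} (ht : 0 < t) (hx : 0 < x) (hy : 0 < y)
    (hz : 0 < z) (h : 2 * z ≤ x + y) :
    x ^ (-t) * (y ^ (-t)) ^ 2 ≤ z ^ (-t) * ((x ^ (-t)) ^ 2 + (y ^ (-t)) ^ 2) := by
  have hX : 0 < x ^ (-t) := by positivity
  have hY : 0 < y ^ (-t) := by positivity
  rcases le_total x y with hxy | hxy
  · have h1 : y ^ (-t) ≤ x ^ (-t) := Real.rpow_le_rpow_of_nonpos hx hxy (by linarith)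
    have h2 : y ^ (-t) ≤ z ^ (-t) := Real.rpow_le_rpow_of_nonpos hz (by linarith) (by linarith)
    calc x ^ (-t) * (y ^ (-t)) ^ 2 = y ^ (-t) * (x ^ (-t) * y ^ (-t)) := by ring
      _ ≤ z ^ (-t) * (x ^ (-t) * x ^ (-t)) := by gcongr
      _ ≤ _ := by
        rw [← sq]
        gcongr
        exact le_add_of_nonneg_right (by positivity)
  · have h2 : x ^ (-t) ≤ z ^ (-t) := Real.rpow_le_rpow_of_nonpos hz (by linarith) (by linarith)
    gcongr
    exact le_add_of_nonneg_left (by positivity)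

lemma summable_rpow_neg_sq {t : ℝ} (ht : 1 / 2 < t) :
    Summable fun m : ℕ => (((m : ℝ) + 1) ^ (-t)) ^ 2 := by
  refine ((Real.summable_one_div_nat_add_rpow 1 (2 * t)).2 (by linarith)).congr fun m => ?_
  have hm : (0 : ℝ) < m + 1 := by positivity
  rw [abs_of_pos hm, ← Real.rpow_natCast, ← Real.rpow_mul hm.le, one_div, ← Real.rpow_neg hm.le]
  congr 1
  push_cast
  ring

lemma sum_rpow_neg_mul_le {t : ℝ} (ht : 1 / 2 < t) {K : ℕ} (hK : 1 ≤ K) :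
    ∑ m ∈ Finset.range (K + 1), ((m : ℝ) + 1) ^ (-t) * (((K - m : ℕ) + 1 : ℝ) ^ (-t)) ^ 2 ≤
      ((K : ℝ) / 2) ^ (-t) * (2 * ∑' m : ℕ, (((m : ℝ) + 1) ^ (-t)) ^ 2) := by
  have hK0 : (0 : ℝ) < K := by exact_mod_cast hK
  have hS := (summable_rpow_neg_sq ht).sum_le_tsum (Finset.range (K + 1))
    (fun m _ => by positivity)
  calc _ ≤ ∑ m ∈ Finset.range (K + 1), ((K : ℝ) / 2) ^ (-t) *
        ((((m : ℝ) + 1) ^ (-t)) ^ 2 + (((K - m : ℕ) + 1 : ℝ) ^ (-t)) ^ 2) := by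
        refine Finset.sum_le_sum fun m hm => ?_
        refine rpow_neg_mul_rpow_neg_sq_le (by linarith) (by positivity) (by positivity)
          (by positivity) ?_
        rw [Nat.cast_sub (Nat.lt_succ_iff.1 (Finset.mem_range.1 hm))]
        linarith
    _ = ((K : ℝ) / 2) ^ (-t) * (2 * ∑ m ∈ Finset.range (K + 1), (((m : ℝ) + 1) ^ (-t)) ^ 2) := by
        rw [← Finset.mul_sum, Finset.sum_add_distrib,
          ← Finset.sum_range_reflect (fun m : ℕ => (((m : ℝ) + 1) ^ (-t)) ^ 2) (K + 1), two_mul]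
        simp only [Nat.add_sub_cancel]
    _ ≤ _ := by gcongr

lemma permProp_mul_succ {d : ℕ} (hd : 0 < d) (m : ℕ) :
    permProp d (d * (m + 1)) = (1 - (1 - 1 / (d : ℝ)) / (m + 1)) * permProp d (d * m) := by
  have hd0 : (d : ℝ) ≠ 0 := by positivity
  have hm : (m + 1 : ℝ) ≠ 0 := by positivity
  have h : (d * m + d : ℝ) = d * (m + 1) := by ring
  rw [mul_add, mul_one, permProp_add hd]
  congr 1
  push_cast
  rw [h]
  field_simp
  ring

lemma sum_permProp_eq {d : ℕ} (hd : 0 < d) (K : ℕ) :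
    ∑ j ∈ Finset.range (d * K + 1), permProp d j * permProp d (d * K - j) ^ 2 =
      ∑ m ∈ Finset.range (K + 1), permProp d (d * m) * permProp d (d * (K - m)) ^ 2 := by
  symm
  simp_rw [Nat.mul_sub]
  refine Finset.sum_of_injOn (d * ·) ?_ ?_ ?_ ?_
  · exact fun _ _ _ _ h => Nat.eq_of_mul_eq_mul_left hd h
  · intro m hm
    simp only [Finset.coe_range, Set.mem_Iio] at hm ⊢
    have := Nat.mul_le_mul_left d (Nat.lt_succ_iff.1 hm)
    omega
  · intro j hj hj'
    have : ¬ d ∣ j := by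
      rintro ⟨m, rfl⟩
      refine hj' ⟨m, ?_, rfl⟩
      have := Nat.le_of_mul_le_mul_left (Nat.lt_succ_iff.1 (Finset.mem_range.1 hj)) hd
      simpa using Nat.lt_succ_iff.2 this
    rw [permProp_eq_zero hd j this, zero_mul]
  · exact fun _ _ => rfl

lemma iProp_eq_card_exists_isDvdInvariant_div (d k₁ k₂ : ℕ) :
    iProp (k₁ + k₂) 2 ![k₁, k₂] ![d, 1] =
      (Nat.card {π : Perm (Fin (k₁ + k₂)) //
        ∃ A : Finset (Fin (k₁ + k₂)), A.card = k₁ ∧ IsDvdInvariant d A π} : ℝ) /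
        (k₁ + k₂).factorial := by
  rw [iProp]
  congr 2
  refine Nat.card_congr (Equiv.subtypeEquivRight fun π => ?_)
  constructor
  · rintro ⟨A, -, hk, hA, hd⟩
    exact ⟨A 0, hk 0, hA 0, hd 0⟩
  · rintro ⟨A, hk, hA, hd⟩
    refine ⟨![A, Aᶜ], ?_, ?_, ?_, ?_⟩
    · simp [Fin.forall_fin_two, disjoint_compl_left, disjoint_compl_right]
    · simp [Fin.forall_fin_two, Finset.card_compl, hk]
    · simp [Fin.forall_fin_two, apply_mem_iff_of_mapsTo hA]
    · simpa [Fin.forall_fin_two] using hd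

lemma iProp_le_permProp (d k₁ k₂ : ℕ) :
    iProp (k₁ + k₂) 2 ![k₁, k₂] ![d, 1] ≤ permProp d k₁ := by
  rw [iProp_eq_card_exists_isDvdInvariant_div, div_le_iff₀' (by positivity)]
  simpa using card_exists_isDvdInvariant_le (α := Fin (k₁ + k₂)) d k₁ (by simp)

lemma permProp_sq_le_iProp_mul (d k₁ k₂ : ℕ) :
    permProp d k₁ ^ 2 ≤ iProp (k₁ + k₂) 2 ![k₁, k₂] ![d, 1] *
      ∑ j ∈ Finset.range (k₁ + 1), permProp d j * permProp d (k₁ - j) ^ 2 := by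
  have h := sq_le_card_exists_isDvdInvariant_mul (α := Fin (k₁ + k₂)) d k₁ (by simp)
  rw [Fintype.card_fin] at h
  have hn : (0 : ℝ) < (k₁ + k₂).factorial := by positivity
  rw [iProp_eq_card_exists_isDvdInvariant_div, div_mul_eq_mul_div, le_div_iff₀ hn]
  refine le_of_mul_le_mul_right ?_ hn
  linarith

theorem stmt_6 (d : ℕ) (hd : 3 ≤ d) :
    ∃ c₁ c₂ : ℝ, 0 < c₁ ∧ 0 < c₂ ∧
      ∀ k₁ k₂ : ℕ, 1 ≤ k₁ → 1 ≤ k₂ → d ∣ k₁ →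
        c₁ * (k₁ : ℝ) ^ (-1 + 1 / (d : ℝ) : ℝ) ≤ iProp (k₁ + k₂) 2 ![k₁, k₂] ![d, 1] ∧
        iProp (k₁ + k₂) 2 ![k₁, k₂] ![d, 1] ≤ c₂ * (k₁ : ℝ) ^ (-1 + 1 / (d : ℝ) : ℝ) := by
  have hd0 : 0 < d := by omega
  have hd3 : (3 : ℝ) ≤ d := by exact_mod_cast hd
  have hdR : (0 : ℝ) < d := by linarith
  set t : ℝ := 1 - 1 / (d : ℝ) with ht
  have hexp : -1 + 1 / (d : ℝ) = -t := by rw [ht]; ring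
  have hinv : 0 < 1 / (d : ℝ) := by positivity
  have hinv3 : 1 / (d : ℝ) ≤ 1 / 3 := one_div_le_one_div_of_le (by norm_num) hd3
  have ht1 : t < 1 := by linarith
  have ht2 : 1 / 2 < t := by linarith
  have ht0 : 0 < t := by linarith
  set b : ℕ → ℝ := fun m => permProp d (d * m) with hb
  have hb0 : b 0 = 1 := permProp_zero d
  have hrec (m : ℕ) : b (m + 1) = (1 - t / (m + 1)) * b m := permProp_mul_succ hd0 m
  have hupper := le_rpow_neg_of_recurrence ht0 ht1 hb0 hrec
  set S : ℝ := ∑' m : ℕ, (((m : ℝ) + 1) ^ (-t)) ^ 2 with hS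
  have hSpos : 0 < S :=
    (summable_rpow_neg_sq ht2).tsum_pos (fun m => by positivity) 0 (by positivity)
  have hpow (K : ℕ) : ((d * K : ℕ) : ℝ) ^ (-t) = (d : ℝ) ^ (-t) * (K : ℝ) ^ (-t) := by
    push_cast
    rw [Real.mul_rpow hdR.le (by positivity)]
  have hdt : 0 < (d : ℝ) ^ (-t) := by positivity
  have h2t : (0 : ℝ) < 2 ^ (-t) := by positivity
  rw [hexp]
  refine ⟨(1 - t) ^ 2 * 2 ^ (-t) / (2 * S * (d : ℝ) ^ (-t)), ((d : ℝ) ^ (-t))⁻¹, ?_,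
    by positivity, ?_⟩
  · have : 0 < 1 - t := by linarith
    positivity
  rintro k₁ k₂ hk₁ - ⟨K, rfl⟩
  have hK : 1 ≤ K := Nat.pos_of_mul_pos_left hk₁
  have hK0 : (0 : ℝ) < K := by exact_mod_cast hK
  have hKt : 0 < (K : ℝ) ^ (-t) := by positivity
  rw [hpow]
  constructor
  · have hlower := mul_rpow_neg_le_of_recurrence ht0 ht1 hb0 hrec hK
    have hsum : ∑ m ∈ Finset.range (K + 1), b m * b (K - m) ^ 2 ≤
        ((K : ℝ) / 2) ^ (-t) * (2 * S) := by
      refine le_trans (Finset.sum_le_sum fun m _ => ?_) (sum_rpow_neg_mul_le ht2 hK)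
      exact mul_le_mul (hupper m) (pow_le_pow_left₀ (permProp_nonneg _ _) (hupper _) 2)
        (by positivity) (by positivity)
    have hmain := permProp_sq_le_iProp_mul d (d * K) k₂
    rw [sum_permProp_eq hd0] at hmain
    set p := iProp (d * K + k₂) 2 ![d * K, k₂] ![d, 1] with hp
    have hp0 : 0 ≤ p := by rw [hp, iProp]; positivity
    have h1 : ((1 - t) * (K : ℝ) ^ (-t)) ^ 2 ≤ p * (((K : ℝ) / 2) ^ (-t) * (2 * S)) :=
      calc ((1 - t) * (K : ℝ) ^ (-t)) ^ 2 ≤ b K ^ 2 :=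
            pow_le_pow_left₀ (mul_nonneg (by linarith) hKt.le) hlower 2
        _ ≤ _ := hmain.trans (mul_le_mul_of_nonneg_left hsum hp0)
    rw [Real.div_rpow hK0.le (by norm_num)] at h1
    rw [show (1 - t) ^ 2 * 2 ^ (-t) / (2 * S * (d : ℝ) ^ (-t)) *
        ((d : ℝ) ^ (-t) * (K : ℝ) ^ (-t)) =
        ((1 - t) * (K : ℝ) ^ (-t)) ^ 2 / ((K : ℝ) ^ (-t) / 2 ^ (-t) * (2 * S)) by field_simp]
    exact div_le_of_le_mul₀ (by positivity) hp0 h1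
  · rw [inv_mul_cancel_left₀ hdt.ne']
    refine (iProp_le_permProp _ _ _).trans ((hupper K).trans ?_)
    exact Real.rpow_le_rpow_of_nonpos hK0 (by linarith) (by linarith)
end
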